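/- arXiv:2507.10961 — 2 statements merged into one kernel-verified Lean document; each statement's English description precedes it below -/
import Mathlib

section
/- (Transformation law of the spatial-frame elastic wrench under left translation; Proposition 2 of the underlying control framework, used in the EquiContact equivariance proof.) Fix real 3×3 matrices K_p and symmetric K_R. For poses g = (p, R) and g_d = (p_d, R_d) with R, R_d ∈ SO(3), define the body-frame elastic wrench f_G(g, g_d) ∈ ℝ⁶ by stacking f_p = Rᵀ R_d K_p R_dᵀ (p − p_d) and f_R = vee(K_R R_dᵀ R − Rᵀ R_d K_R), and define the spatial-frame elastic wrench F^s(g, g_d) = Ad(g⁻¹)ᵀ · f_G(g, g_d). Then for every g_l ∈ SE(3): F^s(g_l · g, g_l · g_d) = Ad(g_l⁻¹)ᵀ · F^s(g, g_d). -/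
open Matrix

/-- An SE(3) element as a pair of a position in `ℝ³` and a `3×3` rotation matrix. -/
abbrev SE3 : Type := (Fin 3 → ℝ) × Matrix (Fin 3) (Fin 3) ℝ

/-- SE(3) multiplication: `(p₁, R₁) · (p₂, R₂) = (p₁ + R₁ p₂, R₁ R₂)`. -/
def se3Mul (g₁ g₂ : SE3) : SE3 := (g₁.1 + g₁.2 *ᵥ g₂.1, g₁.2 * g₂.2)

/-- SE(3) inverse: `(p, R)⁻¹ = (−Rᵀ p, Rᵀ)`. -/
def se3Inv (g : SE3) : SE3 := (-(g.2ᵀ *ᵥ g.1), g.2ᵀ)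

/-- Membership in SO(3): orthogonal with determinant one. -/
def IsSO3 (R : Matrix (Fin 3) (Fin 3) ℝ) : Prop := Rᵀ * R = 1 ∧ R.det = 1

/-- The cross-product (hat) matrix of `v ∈ ℝ³`, satisfying `hat v *ᵥ w = v ×₃ w`. -/
def hat (v : Fin 3 → ℝ) : Matrix (Fin 3) (Fin 3) ℝ :=
  !![0, -v 2, v 1;
     v 2, 0, -v 0;
     -v 1, v 0, 0]

/-- The vee map, inverse of `hat` on skew-symmetric matrices. -/
def vee (M : Matrix (Fin 3) (Fin 3) ℝ) : Fin 3 → ℝ := ![M 2 1, M 0 2, M 1 0]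

/-- The adjoint matrix of `g = (p, R)`: the `6×6` block matrix
`Ad(g) = [[R, hat(p)·R], [0, R]]`. -/
def Ad (g : SE3) : Matrix (Fin 3 ⊕ Fin 3) (Fin 3 ⊕ Fin 3) ℝ :=
  Matrix.fromBlocks g.2 (hat g.1 * g.2) 0 g.2

/-- The body-frame geometric elastic wrench of a current pose `g = (p, R)`
relative to a desired pose `g_d = (p_d, R_d)` with gains `K_p, K_R`: the 6-vector
stacking `f_p = Rᵀ R_d K_p R_dᵀ (p − p_d)` and `f_R = vee (K_R R_dᵀ R − Rᵀ R_d K_R)`. -/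
def elasticWrench (Kp KR : Matrix (Fin 3) (Fin 3) ℝ) (g gd : SE3) :
    (Fin 3 ⊕ Fin 3) → ℝ :=
  Sum.elim ((g.2ᵀ * gd.2 * Kp * gd.2ᵀ) *ᵥ (g.1 - gd.1))
    (vee (KR * gd.2ᵀ * g.2 - g.2ᵀ * gd.2 * KR))

/-- The spatial-frame elastic wrench `F^s(g, g_d) = Ad(g⁻¹)ᵀ · f_G(g, g_d)`. -/
def spatialWrench (Kp KR : Matrix (Fin 3) (Fin 3) ℝ) (g gd : SE3) :
    (Fin 3 ⊕ Fin 3) → ℝ :=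
  (Ad (se3Inv g))ᵀ *ᵥ elasticWrench Kp KR g gd

theorem IsSO3.transpose {R : Matrix (Fin 3) (Fin 3) ℝ} (hR : IsSO3 R) : IsSO3 Rᵀ :=
  ⟨by rw [transpose_transpose]; exact mul_eq_one_comm.mp hR.1, by rw [det_transpose, hR.2]⟩

theorem hat_add (v w : Fin 3 → ℝ) : hat (v + w) = hat v + hat w := by
  ext i j
  fin_cases i <;> fin_cases j <;> simp [hat] <;> ring

theorem transpose_mul_hat_mulVec_mul (A : Matrix (Fin 3) (Fin 3) ℝ) (v : Fin 3 → ℝ) :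
    Aᵀ * (hat (A *ᵥ v) * A) = A.det • hat v := by
  ext i j
  fin_cases i <;> fin_cases j <;>
    simp [hat, det_fin_three, Matrix.mul_apply, mulVec, vecMul, dotProduct,
      Fin.sum_univ_three] <;> ring

theorem IsSO3.hat_mulVec_mul {R : Matrix (Fin 3) (Fin 3) ℝ} (hR : IsSO3 R) (v : Fin 3 → ℝ) :
    hat (R *ᵥ v) * R = R * hat v := by
  have h := congrArg (R * ·) (transpose_mul_hat_mulVec_mul R v)
  simpa [← Matrix.mul_assoc, mul_eq_one_comm.mp hR.1, hR.2] using h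

theorem Ad_se3Mul {g₁ : SE3} (h₁ : IsSO3 g₁.2) (g₂ : SE3) :
    Ad (se3Mul g₁ g₂) = Ad g₁ * Ad g₂ := by
  simp only [Ad, se3Mul, fromBlocks_multiply, hat_add, Matrix.add_mul, ← Matrix.mul_assoc,
    h₁.hat_mulVec_mul, Matrix.mul_zero, Matrix.zero_mul, add_zero, zero_add]
  rw [add_comm]

theorem se3Inv_se3Mul {g₁ : SE3} (h₁ : IsSO3 g₁.2) (g₂ : SE3) :
    se3Inv (se3Mul g₁ g₂) = se3Mul (se3Inv g₂) (se3Inv g₁) := by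
  ext1
  · simp [se3Inv, se3Mul, mulVec_add, mulVec_neg, Matrix.mul_assoc, h₁.1]
  · simp [se3Inv, se3Mul]

/-- The body-frame elastic wrench is invariant under left translation of both poses. -/
theorem elasticWrench_se3Mul (Kp KR : Matrix (Fin 3) (Fin 3) ℝ) (g gd : SE3) {gl : SE3}
    (hgl : IsSO3 gl.2) :
    elasticWrench Kp KR (se3Mul gl g) (se3Mul gl gd) = elasticWrench Kp KR g gd := by
  have cancel (A : Matrix (Fin 3) (Fin 3) ℝ) : gl.2ᵀ * (gl.2 * A) = A := by
    rw [← Matrix.mul_assoc, hgl.1, Matrix.one_mul]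
  simp only [elasticWrench, se3Mul, transpose_mul, Matrix.mul_assoc, cancel,
    add_sub_add_left_eq_sub, ← mulVec_sub, mulVec_mulVec, hgl.1, Matrix.mul_one]

/-- Transformation law of the spatial-frame elastic wrench under left translation
(Proposition 2 of the underlying control framework): for every `g_l ∈ SE(3)`,
`F^s(g_l · g, g_l · g_d) = Ad(g_l⁻¹)ᵀ · F^s(g, g_d)`. -/
theorem spatialWrench_left_transformation
    (Kp KR : Matrix (Fin 3) (Fin 3) ℝ) (hKR : KRᵀ = KR)
    (g gd gl : SE3)
    (hg : IsSO3 g.2) (hgd : IsSO3 gd.2) (hgl : IsSO3 gl.2) :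
    spatialWrench Kp KR (se3Mul gl g) (se3Mul gl gd)
      = (Ad (se3Inv gl))ᵀ *ᵥ spatialWrench Kp KR g gd := by
  rw [spatialWrench, spatialWrench, elasticWrench_se3Mul Kp KR g gd hgl, se3Inv_se3Mul hgl,
    Ad_se3Mul (g₁ := se3Inv g) hg.transpose, transpose_mul, mulVec_mulVec]
end

section
/- (Body-frame left-invariance of the EquiContact policy.) Let π be any function taking a pair (a vector in ℝ³ and a real 3×3 matrix) and a force-torque reading F_e ∈ ℝ⁶, and returning a relative SE(3) pose together with gain matrices: π(e, F_e) = ((q, S), K_p, K_R) with q ∈ ℝ³, S ∈ SO(3), K_p a 3×3 matrix and K_R a symmetric 3×3 matrix. Define the desired pose g_d(g, g_ref, F_e) = g · (pose part of π(e_G(g, g_ref), F_e)), where e_G(g, g_ref) = (Rᵀ(p − p_ref), R_refᵀ R − Rᵀ R_ref), and define the body-frame output wrench h(g, g_ref, F_e) ∈ ℝ⁶ as the geometric elastic wrench of g relative to g_d(g, g_ref, F_e) with the gains output by π. Then for every g_l ∈ SE(3): h(g_l · g, g_l · g_ref, F_e) = h(g, g_ref, F_e). -/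
open Matrix

/-- The geometrically consistent error vector (GCEV) between a current pose
`g = (p, R)` and a reference pose `g_ref = (p_ref, R_ref)`. -/
def gcev (g gref : SE3) : (Fin 3 → ℝ) × Matrix (Fin 3) (Fin 3) ℝ :=
  (g.2ᵀ *ᵥ (g.1 - gref.1), gref.2ᵀ * g.2 - g.2ᵀ * gref.2)

/-- The body-frame output wrench of the EquiContact policy `π`: the geometric
elastic wrench of `g` relative to the desired pose `g_d = g · (pose part of
π(e_G(g, g_ref), F_e))`, with the gains output by `π`. -/
def equiContactWrench
    (π : (Fin 3 → ℝ) × Matrix (Fin 3) (Fin 3) ℝ → (Fin 6 → ℝ) →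
      SE3 × Matrix (Fin 3) (Fin 3) ℝ × Matrix (Fin 3) (Fin 3) ℝ)
    (g gref : SE3) (Fe : Fin 6 → ℝ) : (Fin 3 ⊕ Fin 3) → ℝ :=
  elasticWrench (π (gcev g gref) Fe).2.1 (π (gcev g gref) Fe).2.2
    g (se3Mul g (π (gcev g gref) Fe).1)

theorem IsSO3.transpose_mul_mul_mul {Q : Matrix (Fin 3) (Fin 3) ℝ} (hQ : IsSO3 Q)
    (A B : Matrix (Fin 3) (Fin 3) ℝ) : (Q * A)ᵀ * (Q * B) = Aᵀ * B := by
  rw [transpose_mul, Matrix.mul_assoc, ← Matrix.mul_assoc Qᵀ, hQ.1, Matrix.one_mul]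

theorem IsSO3.transpose_mul_mulVec_mulVec {Q : Matrix (Fin 3) (Fin 3) ℝ} (hQ : IsSO3 Q)
    (A : Matrix (Fin 3) (Fin 3) ℝ) (v : Fin 3 → ℝ) : (Q * A)ᵀ *ᵥ (Q *ᵥ v) = Aᵀ *ᵥ v := by
  rw [transpose_mul, mulVec_mulVec, Matrix.mul_assoc, hQ.1, Matrix.mul_one]

theorem se3Mul_assoc (a b c : SE3) : se3Mul (se3Mul a b) c = se3Mul a (se3Mul b c) := by
  simp only [se3Mul, mulVec_add, mulVec_mulVec, Matrix.mul_assoc, add_assoc]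

theorem se3Mul_fst_sub_fst (gl a b : SE3) :
    (se3Mul gl a).1 - (se3Mul gl b).1 = gl.2 *ᵥ (a.1 - b.1) := by
  simp only [se3Mul, add_sub_add_left_eq_sub, mulVec_sub]

/-- The GCEV is invariant under a common left translation. -/
theorem gcev_se3Mul_left {gl : SE3} (hgl : IsSO3 gl.2) (g gref : SE3) :
    gcev (se3Mul gl g) (se3Mul gl gref) = gcev g gref := by
  simp only [gcev, se3Mul_fst_sub_fst]
  simp only [se3Mul, hgl.transpose_mul_mul_mul, hgl.transpose_mul_mulVec_mulVec]

/-- The geometric elastic wrench is invariant under a common left translation. -/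
theorem elasticWrench_se3Mul_left (Kp KR : Matrix (Fin 3) (Fin 3) ℝ) {gl : SE3}
    (hgl : IsSO3 gl.2) (g gd : SE3) :
    elasticWrench Kp KR (se3Mul gl g) (se3Mul gl gd) = elasticWrench Kp KR g gd := by
  simp only [elasticWrench, se3Mul_fst_sub_fst, Matrix.mul_assoc KR]
  simp only [se3Mul, ← mulVec_mulVec, hgl.transpose_mul_mulVec_mulVec]
  simp only [mulVec_mulVec, hgl.transpose_mul_mul_mul]

/-- Body-frame left-invariance of the EquiContact policy: for any policy `π`
returning a relative pose (with rotation part in SO(3)) together with a gain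
matrix `K_p` and a symmetric gain matrix `K_R`, the body-frame output wrench
satisfies `h(g_l · g, g_l · g_ref, F_e) = h(g, g_ref, F_e)` for every
`g_l ∈ SE(3)`. -/
theorem equiContactWrench_left_invariant
    (π : (Fin 3 → ℝ) × Matrix (Fin 3) (Fin 3) ℝ → (Fin 6 → ℝ) →
      SE3 × Matrix (Fin 3) (Fin 3) ℝ × Matrix (Fin 3) (Fin 3) ℝ)
    (hπ : ∀ e Fe, IsSO3 (π e Fe).1.2 ∧ ((π e Fe).2.2)ᵀ = (π e Fe).2.2)
    (g gref gl : SE3)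
    (hg : IsSO3 g.2) (hgref : IsSO3 gref.2) (hgl : IsSO3 gl.2)
    (Fe : Fin 6 → ℝ) :
    equiContactWrench π (se3Mul gl g) (se3Mul gl gref) Fe
      = equiContactWrench π g gref Fe := by
  simp only [equiContactWrench, gcev_se3Mul_left hgl, se3Mul_assoc,
    elasticWrench_se3Mul_left _ _ hgl]
end
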